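/- Let 2 ≤ k < s ≤ n be integers with n divisible by s. Then there exists a k-graph H on n vertices with δ_{k−1}(H) ≥ ⌊n/2⌋ − k that has no perfect C_s^k-tiling; in particular t_{k−1}(n, C_s^k) ≥ ⌊n/2⌋ − k. Moreover, if the pair (k,s) is admissible, then: if k is even there exists such an H with δ_{k−1}(H) ≥ ⌊(1/2 + 1/(2s))n⌋ − k, and if k is odd there exists such an H with δ_{k−1}(H) ≥ ⌊(1/2 + k/(4s(k−1) + 2k))n⌋ − k. -/

import Mathlib

set_option autoImplicit false

open Finset

section Defs

variable {V : Type} [Fintype V] [DecidableEq V]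

/-- `E` is the edge set of a `k`-uniform hypergraph on `V`. -/
def IsKGraph (k : ℕ) (E : Finset (Finset V)) : Prop := ∀ e ∈ E, e.card = k

/-- The degree of a vertex set `S`: the number of edges containing `S`. -/
def degS (E : Finset (Finset V)) (S : Finset V) : ℕ := (E.filter fun e => S ⊆ e).card

/-- `C` is the (cyclically ordered) vertex list of a copy of a tight cycle:
the vertices are distinct and every `k` cyclically consecutive vertices form an edge. -/
def IsTightCycleList (k : ℕ) (E : Finset (Finset V)) (C : List V) : Prop :=
  C.Nodup ∧ ∀ i < C.length, (((C ++ C).drop i).take k).toFinset ∈ E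

/-- `H` has a `C_s^k`-covering: every vertex lies in a copy of the tight cycle on `s` vertices. -/
def HasCsCovering (k s : ℕ) (E : Finset (Finset V)) : Prop :=
  ∀ v : V, ∃ C : List V, C.length = s ∧ IsTightCycleList k E C ∧ v ∈ C

/-- `H` contains a copy of `C_s^k`. -/
def HasCsCopy (k s : ℕ) (E : Finset (Finset V)) : Prop :=
  ∃ C : List V, C.length = s ∧ IsTightCycleList k E C

/-- `A` is the vertex set of a copy of `C_s^k` in `H`. -/
def SpansCs (k s : ℕ) (E : Finset (Finset V)) (A : Finset V) : Prop :=
  ∃ C : List V, C.length = s ∧ IsTightCycleList k E C ∧ C.toFinset = A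

/-- a `C_s^k`-tiling: a set of pairwise disjoint vertex sets of copies of `C_s^k`. -/
def IsCsTiling (k s : ℕ) (E : Finset (Finset V)) (T : Finset (Finset V)) : Prop :=
  (T : Set (Finset V)).PairwiseDisjoint id ∧ ∀ A ∈ T, SpansCs k s E A

/-- a perfect `C_s^k`-tiling of the induced subgraph on `U`. -/
def HasPerfectCsTilingOn (k s : ℕ) (E : Finset (Finset V)) (U : Finset V) : Prop :=
  ∃ T : Finset (Finset V), IsCsTiling k s E T ∧ T.biUnion id = U

/-- a perfect `C_s^k`-tiling of `H`. -/
def HasPerfectCsTiling (k s : ℕ) (E : Finset (Finset V)) : Prop :=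
  HasPerfectCsTilingOn k s E Finset.univ

/-- the pair `(k,s)` is admissible if `gcd k s = 1` or `k / gcd k s` is even. -/
def AdmissiblePair (k s : ℕ) : Prop := Nat.gcd k s = 1 ∨ Even (k / Nat.gcd k s)

/-- The `k`-graph `H₀^k(A,B)`: edges are the `k`-subsets `e` of `A ∪ B`
with `|e ∩ A| ≢ k (mod 2)`. -/
def H0edges (k : ℕ) (A B : Finset V) : Finset (Finset V) :=
  ((A ∪ B).powersetCard k).filter fun e => ¬ (e ∩ A).card % 2 = k % 2

/-- `P` is (the vertex list of) a tight path: distinct vertices, every `k`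
consecutive vertices form an edge. -/
def IsTightPath (k : ℕ) (E : Finset (Finset V)) (P : List V) : Prop :=
  P.Nodup ∧ ∀ i, i + k ≤ P.length → ((P.drop i).take k).toFinset ∈ E

/-- `P = v₁ ⋯ v_ℓ` has start of type `σ` w.r.t. classes `Vc`: `v_i ∈ V_{σ(i)}`
for `1 ≤ i ≤ k-1` (0-indexed below). -/
def hasStartType (k : ℕ) (Vc : Fin k → Finset V) (P : List V) (σ : Equiv.Perm (Fin k)) : Prop :=
  k ≤ P.length + 1 ∧ ∀ j : Fin k, (j : ℕ) + 1 < k → ∀ v ∈ P[(j : ℕ)]?, v ∈ Vc (σ j)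

/-- `P = v₁ ⋯ v_ℓ` has end of type `σ` w.r.t. classes `Vc`: `v_{ℓ-k+i} ∈ V_{σ(i)}`
for `2 ≤ i ≤ k` (0-indexed below). -/
def hasEndType (k : ℕ) (Vc : Fin k → Finset V) (P : List V) (σ : Equiv.Perm (Fin k)) : Prop :=
  k ≤ P.length + 1 ∧ ∀ j : Fin k, (j : ℕ) ≠ 0 →
    ∀ v ∈ P[(P.length + (j : ℕ) - k)]?, v ∈ Vc (σ j)

/-- `Vc` are the classes of a complete `(k,k)`-graph in `H`: nonempty, pairwise disjoint,
and every transversal is an edge. -/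
def IsCompletePartite (k : ℕ) (E : Finset (Finset V)) (Vc : Fin k → Finset V) : Prop :=
  (∀ i, (Vc i).Nonempty) ∧ (∀ i j, i ≠ j → Disjoint (Vc i) (Vc j)) ∧
  ∀ g : Fin k → V, (∀ i, g i ∈ Vc i) → Finset.image g Finset.univ ∈ E

/-- the cyclic permutation `τ = (1 2 ⋯ k)` (0-indexed: `j ↦ j + 1 mod k`). -/
def cyc (k : ℕ) : Equiv.Perm (Fin k) := finRotate k

/-- `W` is a `G`-gadget for the complete `(k,k)`-graph with classes `Vc` avoiding `S`. -/
def IsGadget (k : ℕ) (E : Finset (Finset V)) (Vc : Fin k → Finset V)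
    (G : SimpleGraph (Fin k)) (S : Finset V) (W : Fin k → Fin k → Finset V) : Prop :=
  (∀ i j, G.Adj i j → W i j = W j i) ∧
  (∀ i j, G.Adj i j →
    (W i j).card = 2 * k - 1 ∧
    (W i j \ Finset.univ.biUnion Vc).card = 1 ∧
    Disjoint (W i j) S ∧
    (∀ i' : Fin k, (W i j ∩ Vc i').card = if i' = i ∨ i' = j then 1 else 2) ∧
    (∀ σ : Equiv.Perm (Fin k), (∃ z : Fin k, (z : ℕ) = 0 ∧ (σ z = i ∨ σ z = j)) →
      ∃ Q : List V, IsTightPath k E Q ∧ Q.toFinset = W i j ∧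
        hasStartType k Vc Q (σ * cyc k) ∧ hasEndType k Vc Q (Equiv.swap i j * σ))) ∧
  (∀ i j i' j', G.Adj i j → G.Adj i' j' → ({i, j} : Finset (Fin k)) ≠ {i', j'} →
    Disjoint (W i j) (W i' j'))

open Classical in
/-- the set of vertices `w_{ij}`, `ij ∈ E(G)`, of a gadget `W`. -/
noncomputable def gadgetVerts (k : ℕ) (Vc : Fin k → Finset V)
    (G : SimpleGraph (Fin k)) (W : Fin k → Fin k → Finset V) : Finset V :=
  (Finset.univ.filter fun p : Fin k × Fin k => G.Adj p.1 p.2).biUnion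
    fun p => W p.1 p.2 \ Finset.univ.biUnion Vc

/-- the graph on `[k]` consisting of the paths given by the lists in `L`. -/
def pathsGraph (k : ℕ) (L : List (List (Fin k))) : SimpleGraph (Fin k) :=
  SimpleGraph.fromEdgeSet {e | ∃ l ∈ L, ∃ p ∈ l.zip l.tail, e = s(p.1, p.2)}

/-- `G` is a vertex-disjoint union of paths. -/
def IsUnionOfPaths (k : ℕ) (G : SimpleGraph (Fin k)) : Prop :=
  ∃ L : List (List (Fin k)), (∀ l ∈ L, l.Nodup) ∧
    L.Pairwise (fun l₁ l₂ => ∀ a ∈ l₁, ∀ b ∈ l₂, a ≠ b) ∧ G = pathsGraph k L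

/-- `m(σ)` (1-indexed), read off from the normalized cycle decomposition `L` of `σ`:
the last element of the last cycle, or `1` if `L` is empty. -/
def mOf (k : ℕ) (L : List (List (Fin k))) : ℕ :=
  ((L.getLast?.bind List.getLast?).map (fun x => (x : ℕ) + 1)).getD 1

/-- `L` is the normalized cycle decomposition of `σ`: disjoint cycles of length ≥ 2,
each cycle listed ending with its minimal element, the cycles ordered by increasing
last elements. -/
def IsNormCycleDecomp (k : ℕ) (σ : Equiv.Perm (Fin k)) (L : List (List (Fin k))) : Prop :=
  (∀ l ∈ L, 2 ≤ l.length ∧ l.Nodup) ∧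
  L.Pairwise (fun l₁ l₂ => ∀ a ∈ l₁, ∀ b ∈ l₂, a ≠ b) ∧
  σ = (L.map List.formPerm).prod ∧
  (∀ l ∈ L, ∀ a ∈ l.getLast?, ∀ b ∈ l, a ≤ b) ∧
  L.Pairwise (fun l₁ l₂ => ∀ a ∈ l₁.getLast?, ∀ b ∈ l₂.getLast?, a < b)

/-- `H` is `(μ, θ)`-dense. -/
def IsDense (k : ℕ) (μ θ : ℝ) (E : Finset (Finset V)) : Prop :=
  ∃ 𝒮 : Finset (Finset V), (∀ S ∈ 𝒮, S.card = k - 1) ∧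
    (𝒮.card : ℝ) ≤ θ * ((Fintype.card V).choose (k - 1)) ∧
    ∀ S : Finset V, S.card = k - 1 → S ∉ 𝒮 →
      μ * ((Fintype.card V : ℝ) - k + 1) ≤ (degS E S : ℝ)

/-- `H` is strongly `(μ, θ)`-dense. -/
def IsStronglyDense (k : ℕ) (μ θ : ℝ) (E : Finset (Finset V)) : Prop :=
  IsDense k μ θ E ∧ ∀ e ∈ E, ∀ X ⊆ e, X.card = k - 1 →
    μ * ((Fintype.card V : ℝ) - k + 1) ≤ (degS E X : ℝ)

/-- the vertex set of `F(K,G)` inside the ambient type: all core vertices, plus one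
pendant vertex for each edge of `G`. -/
def FsVertexSet (k : ℕ) (a : Fin k → ℕ) (G : SimpleGraph (Fin k)) :
    Set ((Σ i : Fin k, Fin (a i)) ⊕ Sym2 (Fin k)) :=
  Set.range Sum.inl ∪ Sum.inr '' G.edgeSet

/-- the edges of `F(K,G)`, where `K = K^k(a)`: all transversals of the classes, plus,
for each edge `ij` of `G`, all `k`-sets consisting of the pendant vertex `w_{ij}` and one
vertex from each class other than `i` (resp. other than `j`). -/
def FKGedges (k : ℕ) (a : Fin k → ℕ) (G : SimpleGraph (Fin k)) :
    Set (Finset ((Σ i : Fin k, Fin (a i)) ⊕ Sym2 (Fin k))) :=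
  {e | (∃ g : ∀ i, Fin (a i), e = Finset.univ.image fun i => Sum.inl ⟨i, g i⟩) ∨
    (∃ i j, G.Adj i j ∧ ∃ g : ∀ i', Fin (a i'),
      e = insert (Sum.inr s(i, j)) ((Finset.univ.erase i).image fun i' => Sum.inl ⟨i', g i'⟩))}

/-- `F(K^k(a), G)` contains a spanning copy of the tight cycle `C_s^k`. -/
def FsHasSpanningCs (k s : ℕ) (a : Fin k → ℕ) (G : SimpleGraph (Fin k)) : Prop :=
  ∃ C : List ((Σ i : Fin k, Fin (a i)) ⊕ Sym2 (Fin k)),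
    C.Nodup ∧ C.length = s ∧ (↑C.toFinset : Set _) = FsVertexSet k a G ∧
    ∀ i < C.length, (((C ++ C).drop i).take k).toFinset ∈ FKGedges k a G

/-- `A` is the vertex set of a copy of `K^k(t)` in `H`. -/
def SpansEsCopy (k t : ℕ) (E : Finset (Finset V)) (A : Finset V) : Prop :=
  ∃ f : Fin k × Fin t → V, Function.Injective f ∧ Finset.univ.image f = A ∧
    ∀ g : Fin k → Fin t, (Finset.univ.image fun i => f (i, g i)) ∈ E

/-- `A` is the vertex set of a copy of `F_s = F(K^k(a), G)` in `H`. -/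
def SpansFsCopy (k : ℕ) (a : Fin k → ℕ) (G : SimpleGraph (Fin k))
    (E : Finset (Finset V)) (A : Finset V) : Prop :=
  ∃ f : ((Σ i : Fin k, Fin (a i)) ⊕ Sym2 (Fin k)) → V,
    Set.InjOn f (FsVertexSet k a G) ∧ f '' FsVertexSet k a G = ↑A ∧
    ∀ e ∈ FKGedges k a G, e.image f ∈ E

/-- `(TF, TE)` is an `{F_s, E_s}`-tiling of `H`, given as the families of vertex sets of
the copies of `F_s` and of `E_s = K^k(max_i a_i)`. -/
def IsFETiling (k : ℕ) (a : Fin k → ℕ) (G : SimpleGraph (Fin k))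
    (E : Finset (Finset V)) (TF TE : Finset (Finset V)) : Prop :=
  ((↑(TF ∪ TE) : Set (Finset V)).PairwiseDisjoint id) ∧
  (∀ A ∈ TF, SpansFsCopy k a G E A) ∧
  (∀ A ∈ TE, SpansEsCopy k (Finset.univ.sup a) E A)

/-- `φ(𝒯) = (n - s(|ℱ_𝒯| + (3/5)|ℰ_𝒯|))/n`. -/
noncomputable def phiTiling (s : ℕ) (TF TE : Finset (Finset V)) : ℝ :=
  ((Fintype.card V : ℝ) - s * ((TF.card : ℝ) + (3 / 5) * (TE.card : ℝ))) / (Fintype.card V : ℝ)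

/-- `φ(H)`: the minimum of `φ(𝒯)` over all `{F_s, E_s}`-tilings of `H`. -/
noncomputable def phiMin (k s : ℕ) (a : Fin k → ℕ) (G : SimpleGraph (Fin k))
    (E : Finset (Finset V)) : ℝ :=
  sInf {x | ∃ TF TE : Finset (Finset V), IsFETiling k a G E TF TE ∧ x = phiTiling s TF TE}

/-- `Φ(n, μ, θ)`: the maximum of `φ(H)` over all `(μ,θ)`-dense `k`-graphs `H` on `n` vertices. -/
noncomputable def PhiMax (k s : ℕ) (a : Fin k → ℕ) (G : SimpleGraph (Fin k))
    (n : ℕ) (μ θ : ℝ) : ℝ :=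
  sSup {x | ∃ E : Finset (Finset (Fin n)), IsKGraph k E ∧ IsDense k μ θ E ∧
    x = phiMin k s a G E}

end Defs

section TightCycles

variable {V : Type} [DecidableEq V]

/-- The `k`-graph whose edges are the `k`-sets which meet `T` or have an odd number of
vertices in `B`. -/
def oddOrMeets [Fintype V] (k : ℕ) (B T : Finset V) : Finset (Finset V) :=
  univ.filter fun e => e.card = k ∧ ((e ∩ T).Nonempty ∨ Odd (e ∩ B).card)

lemma mem_oddOrMeets [Fintype V] {k : ℕ} {B T e : Finset V} :
    e ∈ oddOrMeets k B T ↔ e.card = k ∧ ((e ∩ T).Nonempty ∨ Odd (e ∩ B).card) := by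
  simp [oddOrMeets]

lemma isKGraph_oddOrMeets [Fintype V] (k : ℕ) (B T : Finset V) : IsKGraph k (oddOrMeets k B T) :=
  fun _ he => (mem_oddOrMeets.1 he).1

lemma card_le_degS {E : Finset (Finset V)} {S X : Finset V} (hX : Disjoint X S)
    (h : ∀ v ∈ X, insert v S ∈ E) : X.card ≤ degS E S := by
  refine card_le_card_of_injOn (fun v => insert v S) ?_ ?_
  · intro v hv
    exact mem_filter.2 ⟨h v hv, subset_insert v S⟩
  · intro v hv w hw hvw
    have hvS : v ∉ S := disjoint_left.1 hX hv
    have : v ∈ insert w S := by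
      have : insert v S = insert w S := hvw
      rw [← this]; exact mem_insert_self v S
    exact (mem_insert.1 this).resolve_right hvS

lemma min_card_le_degS_oddOrMeets [Fintype V] {k : ℕ} (hk : 1 ≤ k) {B T : Finset V} (hBT : Disjoint B T)
    {S : Finset V} (hS : S.card = k - 1) :
    min (B.card + T.card) (Fintype.card V - B.card) ≤ degS (oddOrMeets k B T) S + (k - 1) := by
  have card_insert' : ∀ v, v ∉ S → (insert v S).card = k := fun v hv => by
    rw [card_insert_of_notMem hv]; omega
  have meets : ∀ v ∈ T, (insert v S ∩ T).Nonempty := fun v hv =>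
    ⟨v, mem_inter.2 ⟨mem_insert_self v S, hv⟩⟩
  rw [← hS]
  rcases Nat.even_or_odd (S ∩ B).card with hp | hp
  · refine (min_le_left _ _).trans ?_
    have := card_le_degS (E := oddOrMeets k B T) (S := S) (X := (B ∪ T) \ S) sdiff_disjoint ?_
    · have h2 := le_card_sdiff S (B ∪ T)
      rw [card_union_of_disjoint hBT] at h2
      omega
    · intro v hv
      simp only [mem_sdiff, mem_union] at hv
      refine mem_oddOrMeets.2 ⟨card_insert' v hv.2, ?_⟩
      rcases hv.1 with hB | hT
      · right
        rw [insert_inter_of_mem hB, card_insert_of_notMem (by simp [hv.2])]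
        exact hp.add_one
      · exact Or.inl (meets v hT)
  · refine (min_le_right _ _).trans ?_
    have := card_le_degS (E := oddOrMeets k B T) (S := S) (X := Bᶜ \ S) sdiff_disjoint ?_
    · have h2 := le_card_sdiff S Bᶜ
      rw [card_compl] at h2
      omega
    · intro v hv
      simp only [mem_sdiff, mem_compl] at hv
      refine mem_oddOrMeets.2 ⟨card_insert' v hv.2, Or.inr ?_⟩
      rwa [insert_inter_of_notMem hv.1]

/-- A copy of `C_s^k` is the image of an `s`-periodic sequence which is injective on periods. -/
lemma SpansCs.exists_seq {k s : ℕ} (hs : 0 < s) (hks : k ≤ s) {E : Finset (Finset V)}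
    {A : Finset V} (h : SpansCs k s E A) :
    ∃ f : ℕ → V, (∀ x y, f x = f y ↔ x % s = y % s) ∧ (range s).image f = A ∧
      ∀ i, (range k).image (fun j => f (i + j)) ∈ E := by
  obtain ⟨C, hC, ⟨hnd, hE⟩, rfl⟩ := h
  have hlt : ∀ x, x % s < C.length := fun x => by rw [hC]; exact Nat.mod_lt x hs
  refine ⟨fun x => C[x % s]'(hlt x), fun x y => hnd.getElem_inj_iff, ?_, fun i => ?_⟩
  · ext v
    simp only [mem_image, mem_range, List.mem_toFinset, List.mem_iff_getElem]
    constructor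
    · rintro ⟨x, -, rfl⟩
      exact ⟨_, hlt x, rfl⟩
    · rintro ⟨x, hx, rfl⟩
      exact ⟨x, hC ▸ hx, by simp [Nat.mod_eq_of_lt (hC ▸ hx : x < s)]⟩
  · have key : (range k).image (fun j => C[(i + j) % s]'(hlt _)) =
        (((C ++ C).drop (i % s)).take k).toFinset := by
      have his : i % s < s := Nat.mod_lt i hs
      have hel : ∀ j (hj : j < k), (((C ++ C).drop (i % s)).take k)[j]'(by
          simp; omega) = C[(i + j) % s]'(hlt _) := by
        intro j hj
        rw [List.getElem_take, List.getElem_drop, List.getElem_append]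
        split_ifs with h1
        · refine (hnd.getElem_inj_iff).2 ?_
          rw [← Nat.mod_add_mod i s j, Nat.mod_eq_of_lt (show i % s + j < s by omega)]
        · refine (hnd.getElem_inj_iff).2 ?_
          rw [← Nat.mod_add_mod i s j, Nat.mod_eq_sub_mod (show s ≤ i % s + j by omega),
            Nat.mod_eq_of_lt (show i % s + j - s < s by omega), hC]
      ext v
      simp only [mem_image, mem_range, List.mem_toFinset]
      rw [List.mem_iff_getElem]
      constructor
      · rintro ⟨j, hj, rfl⟩
        exact ⟨j, by simp; omega, hel j hj⟩
      · rintro ⟨j, hj, rfl⟩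
        have hjk : j < k := by simp at hj; omega
        exact ⟨j, hjk, (hel j hjk).symm⟩
    rw [key]
    exact hE _ (hlt i)

lemma card_image_inter_eq_sum {k s : ℕ} (hks : k ≤ s) {f : ℕ → V}
    (hf : ∀ x y, f x = f y ↔ x % s = y % s) (i : ℕ) (B : Finset V) :
    ((range k).image (fun j => f (i + j)) ∩ B).card =
      ∑ j ∈ range k, if f (i + j) ∈ B then 1 else 0 := by
  rw [← filter_mem_eq_inter, filter_image, card_image_of_injOn, card_filter]
  intro x hx y hy hxy
  simp only [coe_filter, mem_range, Set.mem_ofPred_eq] at hx hy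
  have h := (hf _ _).1 hxy
  have : x ≡ y [MOD s] := Nat.ModEq.add_left_cancel' i h
  exact Nat.ModEq.eq_of_lt_of_lt this (by omega) (by omega)

lemma sum_range_add_eq_of_periodic {g : ℕ → ℕ} {s : ℕ} (hg : ∀ i, g (i + s) = g i) (j : ℕ) :
    ∑ i ∈ range s, g (i + j) = ∑ i ∈ range s, g i := by
  induction j with
  | zero => rfl
  | succ j ih =>
    have h1 := sum_range_succ (fun i => g (i + j)) s
    rw [sum_range_succ'] at h1
    have h2 : g (s + j) = g (0 + j) := by rw [add_comm, hg, zero_add]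
    rw [h2] at h1
    rw [← ih, ← Nat.add_right_cancel h1]
    exact sum_congr rfl fun i _ => by congr 1; ring

lemma sum_range_mul_of_periodic {g : ℕ → ℕ} {d : ℕ} (hg : ∀ i, g (i + d) = g i) (q : ℕ) :
    ∑ i ∈ range (q * d), g i = q * ∑ i ∈ range d, g i := by
  induction q with
  | zero => simp
  | succ q ih =>
    have h : ∀ q i, g (q * d + i) = g i := by
      intro q i
      induction q with
      | zero => simp
      | succ q ih => rw [← ih, ← hg (q * d + i)]; congr 1; ring
    rw [Nat.succ_mul, sum_range_add, ih, Nat.succ_mul]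
    simp [h]

lemma periodic_gcd {α : Type} {g : ℕ → α} {k s : ℕ} (hs : 0 < s) (hgk : ∀ i, g (i + k) = g i)
    (hgs : ∀ i, g (i + s) = g i) (i : ℕ) : g (i + k.gcd s) = g i := by
  have mul : ∀ c, (∀ i, g (i + c) = g i) → ∀ m i, g (i + m * c) = g i := by
    intro c hc m i
    induction m with
    | zero => simp
    | succ m ih => rw [Nat.succ_mul, ← add_assoc, hc, ih]
  have hle : k.gcd s ≤ s := Nat.gcd_le_right k hs
  rcases hle.eq_or_lt with he | hlt
  · rw [he, hgs]
  · obtain ⟨m, -, hm⟩ := Nat.exists_mul_mod_eq_gcd hlt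
    have h1 := Nat.div_add_mod (k * m) s
    rw [hm] at h1
    calc g (i + k.gcd s) = g (i + k.gcd s + (k * m / s) * s) := (mul s hgs _ _).symm
      _ = g (i + m * k) := by
        congr 1; linarith
      _ = g i := mul k hgk _ _

/-- A copy of `C_s^k` avoiding `T` has `d`-periodic intersection with `B`, where
`d = gcd k s`, and an odd number of vertices of `B` in each period. -/
lemma SpansCs.exists_odd_of_disjoint [Fintype V] {k s : ℕ} (hks : k < s) {B T A : Finset V}
    (h : SpansCs k s (oddOrMeets k B T) A) (hAT : A ∩ T = ∅) :
    ∃ β, Odd β ∧ β ≤ k.gcd s ∧ Odd (k / k.gcd s) ∧ (A ∩ B).card = s / k.gcd s * β := by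
  have hs : 0 < s := by omega
  obtain ⟨f, hf, rfl, hE⟩ := h.exists_seq hs hks.le
  set g : ℕ → ℕ := fun i => if f i ∈ B then 1 else 0 with hg
  have hfs : ∀ i, f (i + s) = f i := fun i => (hf _ _).2 (by simp)
  have hgs : ∀ i, g (i + s) = g i := fun i => by simp only [hg, hfs]
  have hfA : ∀ i, f i ∉ T := fun i hi => by
    have : f i ∈ (range s).image f ∩ T := mem_inter.2
      ⟨mem_image.2 ⟨i % s, mem_range.2 (Nat.mod_lt i hs), (hf _ _).2 (Nat.mod_mod _ _)⟩, hi⟩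
    simp [hAT] at this
  have hodd : ∀ i, Odd (∑ j ∈ range k, g (i + j)) := fun i => by
    rw [← card_image_inter_eq_sum hks.le hf i B]
    refine (mem_oddOrMeets.1 (hE i)).2.resolve_left ?_
    rintro ⟨v, hv⟩
    simp only [mem_inter, mem_image] at hv
    obtain ⟨⟨j, -, rfl⟩, hv⟩ := hv
    exact hfA _ hv
  have hgk : ∀ i, g (i + k) = g i := fun i => by
    have h0 := hodd i
    have h1 := hodd (i + 1)
    have h2 := sum_range_succ (fun j => g (i + j)) k
    rw [sum_range_succ'] at h2
    have h3 : ∑ j ∈ range k, g (i + 1 + j) = ∑ j ∈ range k, g (i + (j + 1)) :=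
      sum_congr rfl fun j _ => by congr 1; ring
    rw [h3] at h1
    have hle : ∀ i, g i ≤ 1 := fun i => by simp only [hg]; split_ifs <;> simp
    have := hle i
    have := hle (i + k)
    rw [Nat.odd_iff] at h0 h1
    simp only [add_zero] at h2
    omega
  have hgd := periodic_gcd hs hgk hgs
  have hk := sum_range_mul_of_periodic hgd (k / k.gcd s)
  have hs' := sum_range_mul_of_periodic hgd (s / k.gcd s)
  rw [Nat.div_mul_cancel (Nat.gcd_dvd_left k s)] at hk
  rw [Nat.div_mul_cancel (Nat.gcd_dvd_right k s)] at hs'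
  have h0 := hodd 0
  simp only [zero_add] at h0
  rw [hk, Nat.odd_mul] at h0
  refine ⟨_, h0.2, ?_, h0.1, ?_⟩
  · calc ∑ i ∈ range (k.gcd s), g i ≤ ∑ i ∈ range (k.gcd s), 1 :=
        sum_le_sum fun i _ => by simp only [hg]; split_ifs <;> simp
      _ = k.gcd s := by simp
  · rw [← hs']
    simpa [hg] using card_image_inter_eq_sum le_rfl hf 0 B

lemma SpansCs.card_eq {k s : ℕ} {E : Finset (Finset V)} {A : Finset V}
    (h : SpansCs k s E A) : A.card = s := by
  obtain ⟨C, hC, ⟨hnd, -⟩, rfl⟩ := h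
  rw [List.toFinset_card_of_nodup hnd, hC]

/-- Each edge meets `B ∪ T`, so a copy of `C_s^k` has at least `s / k` vertices there. -/
lemma SpansCs.le_mul_card_inter_union [Fintype V] {k s : ℕ} (hks : k < s) {B T A : Finset V}
    (h : SpansCs k s (oddOrMeets k B T) A) : s ≤ k * (A ∩ (B ∪ T)).card := by
  have hs : 0 < s := by omega
  obtain ⟨f, hf, rfl, hE⟩ := h.exists_seq hs hks.le
  set g : ℕ → ℕ := fun i => if f i ∈ B ∪ T then 1 else 0 with hg
  have hgs : ∀ i, g (i + s) = g i := fun i => by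
    simp only [hg, (hf (i + s) i).2 (by simp)]
  have hA : ((range s).image f ∩ (B ∪ T)).card = ∑ i ∈ range s, g i := by
    simpa [hg] using card_image_inter_eq_sum le_rfl hf 0 (B ∪ T)
  have hpos : ∀ i, 1 ≤ ∑ j ∈ range k, g (i + j) := fun i => by
    rw [← card_image_inter_eq_sum hks.le hf i (B ∪ T), Nat.one_le_iff_ne_zero, card_ne_zero]
    rcases (mem_oddOrMeets.1 (hE i)).2 with hT | hB
    · exact hT.mono (inter_subset_inter_left subset_union_right)
    · exact (card_pos.1 hB.pos).mono (inter_subset_inter_left subset_union_left)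
  calc s = ∑ i ∈ range s, 1 := by simp
    _ ≤ ∑ i ∈ range s, ∑ j ∈ range k, g (i + j) := sum_le_sum fun i _ => hpos i
    _ = ∑ j ∈ range k, ∑ i ∈ range s, g (i + j) := sum_comm
    _ = k * ((range s).image f ∩ (B ∪ T)).card := by
      simp [sum_range_add_eq_of_periodic hgs, hA]

lemma sum_card_inter_of_perfect [Fintype V] {P : Finset (Finset V)}
    (hd : (P : Set (Finset V)).PairwiseDisjoint id) (hP : P.biUnion id = univ) (X : Finset V) :
    ∑ A ∈ P, (A ∩ X).card = X.card := by
  rw [← card_biUnion]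
  · congr 1
    ext v
    have hv : v ∈ P.biUnion id := hP ▸ mem_univ v
    simp only [mem_biUnion, id, mem_inter] at hv ⊢
    obtain ⟨A, hA, hvA⟩ := hv
    exact ⟨fun ⟨_, _, _, h⟩ => h, fun h => ⟨A, hA, hvA, h⟩⟩
  · intro A hA A' hA' hne
    exact (hd hA hA' hne).mono inter_subset_left inter_subset_left

lemma card_mul_of_perfect [Fintype V] {k s : ℕ} {E P : Finset (Finset V)} (hP : IsCsTiling k s E P)
    (hU : P.biUnion id = univ) : P.card * s = Fintype.card V := by
  have h := sum_card_inter_of_perfect hP.1 hU univ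
  rw [sum_congr rfl fun A hA => by rw [inter_univ, (hP.2 A hA).card_eq]] at h
  simpa using h

lemma exists_disjoint_card_eq [Fintype V] {b t : ℕ} (h : b + t ≤ Fintype.card V) :
    ∃ B T : Finset V, Disjoint B T ∧ B.card = b ∧ T.card = t := by
  obtain ⟨T, -, hT⟩ := exists_subset_card_eq (s := (univ : Finset V)) (n := t)
    (by rw [card_univ]; omega)
  obtain ⟨B, hB, hBc⟩ := exists_subset_card_eq (s := Tᶜ) (n := b) (by rw [card_compl]; omega)
  exact ⟨B, T, disjoint_of_subset_left hB disjoint_compl_left, hBc, hT⟩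

lemma not_hasPerfectCsTiling_of_parity [Fintype V] {k s : ℕ} (hks : k < s) {B : Finset V}
    (hB : B.card % 2 ≠ Fintype.card V / k.gcd s % 2) :
    ¬ HasPerfectCsTiling k s (oddOrMeets k B ∅) := by
  rintro ⟨P, hP, hU⟩
  apply hB
  rw [← card_mul_of_perfect hP hU, ← sum_card_inter_of_perfect hP.1 hU B,
    Nat.mul_div_assoc _ (Nat.gcd_dvd_right k s), ← smul_eq_mul, ← sum_const]
  refine Nat.ModEq.sum fun A hA => ?_
  obtain ⟨β, hβ, -, -, h⟩ := (hP.2 A hA).exists_odd_of_disjoint hks (inter_empty A)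
  rw [h, Nat.ModEq, Nat.mul_mod, Nat.odd_iff.1 hβ]
  simp

lemma not_hasPerfectCsTiling_of_even [Fintype V] {k s : ℕ} (hks : k < s) (he : Even (k / k.gcd s))
    {B T : Finset V} (hT : T.card * s < Fintype.card V) :
    ¬ HasPerfectCsTiling k s (oddOrMeets k B T) := by
  rintro ⟨P, hP, hU⟩
  have h1 : P.card ≤ T.card := by
    rw [← sum_card_inter_of_perfect hP.1 hU T, card_eq_sum_ones]
    refine sum_le_sum fun A hA => ?_
    rw [Nat.one_le_iff_ne_zero]
    intro h0
    obtain ⟨_, -, -, ho, -⟩ := (hP.2 A hA).exists_odd_of_disjoint hks (card_eq_zero.1 h0)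
    exact Nat.not_even_iff_odd.2 ho he
  have h2 := card_mul_of_perfect hP hU
  have := Nat.mul_le_mul_right s h1
  omega

lemma not_hasPerfectCsTiling_of_coprime [Fintype V] {k s : ℕ} (hks : k < s) (hc : k.gcd s = 1)
    {B T : Finset V} (hT : s * (k - 1) * T.card < k * (B ∪ T)ᶜ.card) :
    ¬ HasPerfectCsTiling k s (oddOrMeets k B T) := by
  rintro ⟨P, hP, hU⟩
  refine hT.not_ge ?_
  rw [← sum_card_inter_of_perfect hP.1 hU T, ← sum_card_inter_of_perfect hP.1 hU (B ∪ T)ᶜ,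
    mul_sum, mul_sum]
  refine sum_le_sum fun A hA => ?_
  have hspan := hP.2 A hA
  have hcard := hspan.card_eq
  have hsplit : (A ∩ (B ∪ T)).card + (A ∩ (B ∪ T)ᶜ).card = s := by
    rw [← hcard, ← sdiff_eq_inter_compl, card_inter_add_card_sdiff]
  rcases Nat.eq_zero_or_pos (A ∩ T).card with h0 | hpos
  · obtain ⟨β, hβ, hβ1, -, h⟩ := hspan.exists_odd_of_disjoint hks (card_eq_zero.1 h0)
    have hβ' : β = 1 := by have := hβ.pos; omega
    rw [hc, hβ', Nat.div_one, mul_one] at h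
    have : (A ∩ B).card ≤ (A ∩ (B ∪ T)).card :=
      card_le_card (inter_subset_inter_left subset_union_left)
    have : (A ∩ (B ∪ T)ᶜ).card = 0 := by omega
    rw [this, mul_zero]
    exact Nat.zero_le _
  · refine le_trans ?_ (Nat.le_mul_of_pos_right _ hpos)
    have h1 := hspan.le_mul_card_inter_union hks
    have h2 : k * (A ∩ (B ∪ T)).card + k * (A ∩ (B ∪ T)ᶜ).card = k * s := by
      rw [← mul_add, hsplit]
    rw [Nat.mul_sub_one, mul_comm s k]
    omega

end TightCycles

/-- lower bounds for the tiling codegree threshold of tight cycles. -/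
theorem tiling_threshold_lower (k s n : ℕ) (hk : 2 ≤ k) (hks : k < s) (hsn : s ≤ n)
    (hdvd : s ∣ n) :
    (∃ E : Finset (Finset (Fin n)), IsKGraph k E ∧ ¬ HasPerfectCsTiling k s E ∧
      ∀ S : Finset (Fin n), S.card = k - 1 →
        ((n / 2 : ℕ) : ℤ) - k ≤ (degS E S : ℤ)) ∧
    (AdmissiblePair k s → Even k →
      ∃ E : Finset (Finset (Fin n)), IsKGraph k E ∧ ¬ HasPerfectCsTiling k s E ∧
        ∀ S : Finset (Fin n), S.card = k - 1 →
          ⌊((1 : ℝ) / 2 + 1 / (2 * (s : ℝ))) * (n : ℝ)⌋ - k ≤ (degS E S : ℤ)) ∧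
    (AdmissiblePair k s → Odd k →
      ∃ E : Finset (Finset (Fin n)), IsKGraph k E ∧ ¬ HasPerfectCsTiling k s E ∧
        ∀ S : Finset (Fin n), S.card = k - 1 →
          ⌊((1 : ℝ) / 2 + (k : ℝ) / (4 * (s : ℝ) * ((k : ℝ) - 1) + 2 * (k : ℝ))) * (n : ℝ)⌋ - k
            ≤ (degS E S : ℤ)) := by
  have hs : 0 < s := by omega
  obtain ⟨q, rfl⟩ := hdvd
  have hq : 1 ≤ q := Nat.pos_of_ne_zero (by rintro rfl; omega)
  have hqn : q ≤ s * q := Nat.le_mul_of_pos_left q hs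
  refine ⟨?_, fun hadm hev => ?_, fun hadm hod => ?_⟩
  · obtain ⟨b, hb, hb1, hb2⟩ : ∃ b, b % 2 ≠ s * q / k.gcd s % 2 ∧ b ≤ s * q / 2 ∧
        s * q / 2 ≤ b + 1 := by
      by_cases h : (s * q / 2) % 2 = s * q / k.gcd s % 2
      · exact ⟨s * q / 2 - 1, by omega, by omega, by omega⟩
      · exact ⟨s * q / 2, h, le_rfl, by omega⟩
    obtain ⟨B, -, -, hB, -⟩ := exists_disjoint_card_eq (V := Fin (s * q)) (b := b) (t := 0)
      (by rw [Fintype.card_fin]; omega)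
    refine ⟨oddOrMeets k B ∅, isKGraph_oddOrMeets _ _ _,
      not_hasPerfectCsTiling_of_parity hks (by rwa [hB, Fintype.card_fin]), fun S hS => ?_⟩
    have h := min_card_le_degS_oddOrMeets (by omega) (disjoint_empty_right B) hS
    rw [hB, card_empty, Fintype.card_fin] at h
    omega
  · have he : Even (k / k.gcd s) := by
      rcases hadm with h | h
      · rwa [h, Nat.div_one]
      · exact h
    obtain ⟨B, T, hBT, hB, hT⟩ := exists_disjoint_card_eq (V := Fin (s * q))
      (b := (s * q - (q - 1)) / 2) (t := q - 1) (by rw [Fintype.card_fin]; omega)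
    refine ⟨oddOrMeets k B T, isKGraph_oddOrMeets _ _ _,
      not_hasPerfectCsTiling_of_even hks he ?_, fun S hS => ?_⟩
    · rw [hT, Fintype.card_fin, mul_comm s q]
      exact Nat.mul_lt_mul_of_pos_right (by omega) hs
    have h := min_card_le_degS_oddOrMeets (by omega) hBT hS
    rw [hB, hT, Fintype.card_fin] at h
    have hfl : ⌊((1 : ℝ) / 2 + 1 / (2 * (s : ℝ))) * ((s * q : ℕ) : ℝ)⌋ ≤
        (((s * q + q) / 2 : ℕ) : ℤ) := by
      have h1 : s * q + q < 2 * ((s * q + q) / 2 + 1) := by omega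
      generalize (s * q + q) / 2 = N at h1 ⊢
      rw [← Int.lt_add_one_iff, Int.floor_lt]
      have h2 : ((s * q + q : ℕ) : ℝ) < ((2 * (N + 1) : ℕ) : ℝ) := by
        exact_mod_cast h1
      have hs' : (s : ℝ) ≠ 0 := by positivity
      have h3 : ((1 : ℝ) / 2 + 1 / (2 * (s : ℝ))) * ((s * q : ℕ) : ℝ) =
          ((s * q + q : ℕ) : ℝ) / 2 := by
        push_cast; field_simp
      rw [h3]
      push_cast at h2 ⊢
      linarith
    omega
  · have hc : k.gcd s = 1 := by
      rcases hadm with h | h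
      · exact h
      · have := Nat.div_mul_cancel (Nat.gcd_dvd_left k s)
        exact absurd (this ▸ h.mul_right _) (Nat.not_even_iff_odd.2 hod)
    generalize s * q = n at *
    set D := 2 * s * (k - 1) + k with hD
    obtain ⟨t, ht1, ht2⟩ : ∃ t, t * D < k * n ∧ k * n ≤ (t + 1) * D := by
      have hkn : 0 < k * n := Nat.mul_pos (by omega) (by omega)
      have hDpos : 0 < D := by omega
      refine ⟨(k * n - 1) / D, ?_, ?_⟩
      · have := Nat.div_mul_le_self (k * n - 1) D
        omega
      · have := Nat.lt_div_mul_add (a := k * n - 1) hDpos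
        rw [Nat.succ_mul]
        omega
    have htn : t < n := by
      have h1 : t * k ≤ t * D := Nat.mul_le_mul_left t (by omega)
      rw [mul_comm k n] at ht1
      exact Nat.lt_of_mul_lt_mul_right (h1.trans_lt ht1)
    obtain ⟨B, T, hBT, hB, hT⟩ := exists_disjoint_card_eq (V := Fin n)
      (b := (n - t) / 2) (t := t) (by rw [Fintype.card_fin]; omega)
    refine ⟨oddOrMeets k B T, isKGraph_oddOrMeets _ _ _,
      not_hasPerfectCsTiling_of_coprime hks hc ?_, fun S hS => ?_⟩
    · rw [card_compl, card_union_of_disjoint hBT, hB, hT, Fintype.card_fin]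
      have h1 : n ≤ 2 * (n - ((n - t) / 2 + t)) + t := by omega
      have h2 := Nat.mul_le_mul_left k h1
      rw [hD] at ht1
      have h3 : t * (2 * s * (k - 1) + k) = 2 * (s * (k - 1) * t) + k * t := by ring
      have h4 : k * (2 * (n - ((n - t) / 2 + t)) + t) =
        2 * (k * (n - ((n - t) / 2 + t))) + k * t := by ring
      omega
    have h := min_card_le_degS_oddOrMeets (by omega) hBT hS
    rw [hB, hT, Fintype.card_fin] at h
    have hfl : ⌊((1 : ℝ) / 2 + (k : ℝ) / (4 * (s : ℝ) * ((k : ℝ) - 1) + 2 * (k : ℝ))) * (n : ℝ)⌋ ≤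
        (((n + t + 1) / 2 : ℕ) : ℤ) := by
      have h0 : n + t + 1 < 2 * ((n + t + 1) / 2 + 1) := by omega
      generalize (n + t + 1) / 2 = N at h0 ⊢
      rw [← Int.lt_add_one_iff, Int.floor_lt]
      have hDr : (D : ℝ) = 2 * s * ((k : ℝ) - 1) + k := by
        rw [hD]; push_cast [Nat.cast_sub (show 1 ≤ k by omega)]; ring
      have hDpos : (0 : ℝ) < D := by exact_mod_cast (show 0 < D by omega)
      have h1 : (n + t + 1 : ℝ) < 2 * (N + 1) := by exact_mod_cast h0
      have h2 : (k * n : ℝ) / D ≤ t + 1 := by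
        rw [div_le_iff₀ hDpos]; exact_mod_cast ht2
      have h3 : ((1 : ℝ) / 2 + (k : ℝ) / (4 * (s : ℝ) * ((k : ℝ) - 1) + 2 * (k : ℝ))) * (n : ℝ) =
          (n + (k * n : ℝ) / D) / 2 := by
        rw [show 4 * (s : ℝ) * ((k : ℝ) - 1) + 2 * (k : ℝ) = 2 * D by rw [hDr]; ring]
        field_simp
      rw [h3]
      push_cast
      linarith
    omega
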